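/- arXiv:2302.10613 — 11 statements merged into one kernel-verified Lean document; each statement's English description precedes it below -/
import Mathlib

section
/- For every bin packing instance (I, s) with I a nonempty finite set and s : I → [0,1], there exists a packing of I into t bins such that t ≤ (1 + 2·max_{ℓ∈I} s(ℓ))·s(I) + 1, where s(I) = Σ_{ℓ∈I} s(ℓ). -/
open Finset

/-- Any-fit packing: items can be distributed over `t` bins of capacity `1` so that of any two
distinct bins at least one has load at least `c`. -/
theorem exists_anyFit_packing {ι : Type*} [DecidableEq ι] (s : ι → ℝ)
    (hs : ∀ x, s x ∈ Set.Icc (0 : ℝ) 1) (c : ℝ) (hc : ∀ x, c ≤ 1 - s x ∨ c ≤ 1 / 2)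
    (S : Finset ι) :
    ∃ (t : ℕ) (f : ι → ℕ), (∀ x ∈ S, f x < t) ∧ (∀ j, ∑ x ∈ S with f x = j, s x ≤ 1) ∧
      ∀ i < t, ∀ j < t, i ≠ j →
        c ≤ ∑ x ∈ S with f x = i, s x ∨ c ≤ ∑ x ∈ S with f x = j, s x := by
  induction S using Finset.induction_on with
  | empty => exact ⟨0, fun _ => 0, by simp, by simp, by simp⟩
  | insert a S ha ih =>
    obtain ⟨t, f, hf, hload, hpair⟩ := ih
    have hupd (k j : ℕ) : ∑ x ∈ insert a S with Function.update f a k x = j, s x =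
        (∑ x ∈ S with f x = j, s x) + if k = j then s a else 0 := by
      rw [Finset.sum_filter, Finset.sum_insert ha, Finset.sum_filter, add_comm]
      congr 1
      · refine Finset.sum_congr rfl fun x hx => ?_
        rw [Function.update_of_ne (ne_of_mem_of_not_mem hx ha)]
      · simp
    have hmem (k t' : ℕ) (hk : k < t') (ht : t ≤ t') :
        ∀ x ∈ insert a S, Function.update f a k x < t' := by
      intro x hx
      by_cases hxa : x = a
      · simpa [hxa] using hk
      · rw [Function.update_of_ne hxa]
        exact (hf x ((Finset.mem_insert.1 hx).resolve_left hxa)).trans_le ht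
    have ha0 := (hs a).1
    have ha1 := (hs a).2
    by_cases hfit : ∃ k < t, (∑ x ∈ S with f x = k, s x) + s a ≤ 1
    · obtain ⟨k, hkt, hk⟩ := hfit
      refine ⟨t, Function.update f a k, hmem k t hkt le_rfl, fun j => ?_, fun i hi j hj hij => ?_⟩
      · rw [hupd]
        split_ifs with h
        · exact h ▸ hk
        · simpa using hload j
      · have hmono (l : ℕ) : ∑ x ∈ S with f x = l, s x ≤
            ∑ x ∈ insert a S with Function.update f a k x = l, s x := by
          rw [hupd]
          split_ifs <;> linarith
        exact (hpair i hi j hj hij).imp (·.trans (hmono i)) (·.trans (hmono j))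
    · push Not at hfit
      have hempty : ∑ x ∈ S with f x = t, s x = 0 := by
        rw [Finset.filter_false_of_mem fun x hx => (hf x hx).ne, Finset.sum_empty]
      refine ⟨t + 1, Function.update f a t, hmem t _ t.lt_succ_self t.le_succ,
        fun j => ?_, fun i hi j hj hij => ?_⟩
      · rw [hupd]
        split_ifs with h
        · rw [← h, hempty]
          linarith
        · simpa using hload j
      · have hnew (l : ℕ) (hl : l < t) : c ≤ ∑ x ∈ S with f x = l, s x ∨ c ≤ s a := by
          have := hfit l hl
          rcases hc a with h | h
          · left; linarith
          · by_contra! hlt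
            linarith [hlt.1, hlt.2]
        rw [hupd, hupd]
        rcases Nat.lt_succ_iff_lt_or_eq.1 hi with hi | rfl
        · rcases Nat.lt_succ_iff_lt_or_eq.1 hj with hj | rfl
          · simpa [hi.ne', hj.ne'] using hpair i hi j hj hij
          · simpa [hi.ne', hempty] using hnew i hi
        · have hj : j < i := by omega
          simpa [hj.ne', hempty] using (hnew j hj).symm

/-- If of any two distinct terms at least one is at least `c`, then a sum of `t` nonnegative
terms is at least `(t - 1) * c`. -/
theorem sub_one_mul_le_sum_range (t : ℕ) (g : ℕ → ℝ) (hg : ∀ i, 0 ≤ g i) (c : ℝ) (hc : 0 ≤ c)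
    (h : ∀ i < t, ∀ j < t, i ≠ j → c ≤ g i ∨ c ≤ g j) :
    ((t : ℝ) - 1) * c ≤ ∑ i ∈ range t, g i := by
  by_cases hall : ∀ i ∈ range t, c ≤ g i
  · have := Finset.card_nsmul_le_sum (range t) g c hall
    rw [card_range, nsmul_eq_mul] at this
    linarith
  · push Not at hall
    obtain ⟨k, hk, hkc⟩ := hall
    have hle := Finset.card_nsmul_le_sum ((range t).erase k) g c fun i hi =>
      (h i (mem_range.1 (mem_of_mem_erase hi)) k (mem_range.1 hk) (ne_of_mem_erase hi)).resolve_right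
        hkc.not_ge
    have hcard := Finset.card_erase_add_one hk
    rw [card_range] at hcard
    rw [nsmul_eq_mul] at hle
    rw [← Finset.add_sum_erase _ _ hk]
    have hcast : (t : ℝ) - 1 = #((range t).erase k) := by
      rw [sub_eq_iff_eq_add]
      exact_mod_cast hcard.symm
    rw [hcast]
    linarith [hg k]

/-- For every bin packing instance `(I, s)` with `I` a nonempty finite set and
`s : I → [0,1]`, there exists a packing of `I` into `t` bins such that
`t ≤ (1 + 2·max_{ℓ∈I} s(ℓ))·s(I) + 1`. -/
theorem stmt_0 {ι : Type*} [Fintype ι] [Nonempty ι]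
    (s : ι → ℝ) (hs : ∀ x, s x ∈ Set.Icc (0 : ℝ) 1) :
    ∃ (t : ℕ) (B : Fin t → Finset ι),
      (∀ x : ι, ∃! i, x ∈ B i) ∧
      (∀ i, ∑ x ∈ B i, s x ≤ 1) ∧
      (t : ℝ) ≤ (1 + 2 * Finset.univ.sup' Finset.univ_nonempty s) * (∑ x, s x) + 1 := by
  classical
  set M := Finset.univ.sup' Finset.univ_nonempty s
  have hM (x : ι) : s x ≤ M := Finset.le_sup' s (mem_univ x)
  have hM0 : 0 ≤ M := (hs (Classical.arbitrary ι)).1.trans (hM _)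
  obtain ⟨c, hc0, hc, hcM⟩ : ∃ c : ℝ, 0 ≤ c ∧ (∀ x, c ≤ 1 - s x ∨ c ≤ 1 / 2) ∧
      1 ≤ (1 + 2 * M) * c := by
    rcases le_total M (1 / 2) with h | h
    · exact ⟨1 - M, by linarith, fun x => .inl (by linarith [hM x]), by nlinarith⟩
    · exact ⟨1 / 2, by norm_num, fun x => .inr le_rfl, by linarith⟩
  obtain ⟨t, f, hf, hload, hpair⟩ := exists_anyFit_packing s hs c hc univ
  refine ⟨t, fun i => {x | f x = i}, fun x => ⟨⟨f x, hf x (mem_univ x)⟩, by simp, ?_⟩,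
    fun i => hload i, ?_⟩
  · intro i hi
    exact Fin.ext (Finset.mem_filter.1 hi).2.symm
  · have hsum := sub_one_mul_le_sum_range t (fun j => ∑ x with f x = j, s x)
      (fun j => Finset.sum_nonneg fun x _ => (hs x).1) c hc0 hpair
    rw [Finset.sum_fiberwise_of_maps_to fun x hx => mem_range.2 (hf x hx)] at hsum
    have hS : 0 ≤ ∑ x, s x := Finset.sum_nonneg fun x _ => (hs x).1
    rcases le_total (t : ℝ) 1 with ht | ht
    · have : 0 ≤ (1 + 2 * M) * ∑ x, s x := by positivity
      linarith
    · have h₁ := mul_le_mul_of_nonneg_left hsum (by positivity : 0 ≤ 1 + 2 * M)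
      have h₂ := mul_le_mul_of_nonneg_left hcM (sub_nonneg.2 ht)
      linarith
end

section
/- For every bin packing instance (I, s) with s : I → [0,1], there exists a packing of I into t bins such that t ≤ |L| + (3/2)·s(M) + (4/3)·s(S) + 1, where L = {ℓ ∈ I : s(ℓ) > 1/2} are the large items, M = {ℓ ∈ I : 1/3 < s(ℓ) ≤ 1/2} the medium items, and S = {ℓ ∈ I : s(ℓ) ≤ 1/3} the small items. -/
open Finset
open scoped Classical

/-- The weight of an item of size `r`. -/
noncomputable def itemWeight (r : ℝ) : ℝ :=
  if 1/2 < r then 1 else if 1/3 < r then 3/2 * r else 4/3 * r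

/-- The items of `C` can be packed into `t` bins, `f x` being the index of the bin of `x`. -/
def Packable {ι : Type*} (s : ι → ℝ) (C : Finset ι) (t : ℕ) : Prop :=
  ∃ f : ι → ℕ, (∀ x ∈ C, f x < t) ∧ ∀ i, ∑ x ∈ C with f x = i, s x ≤ 1

theorem itemWeight_nonneg {r : ℝ} (h : 0 ≤ r) : 0 ≤ itemWeight r := by
  unfold itemWeight
  split_ifs <;> linarith

theorem four_thirds_mul_le_itemWeight {r : ℝ} (h : r ≤ 1/2) :
    4/3 * r ≤ itemWeight r := by
  unfold itemWeight
  split_ifs <;> linarith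

theorem one_le_sum_itemWeight {ι : Type*} {s : ι → ℝ} (h0 : ∀ x, 0 ≤ s x) {C : Finset ι}
    (h : 3/4 ≤ ∑ x ∈ C, s x) : 1 ≤ ∑ x ∈ C, itemWeight (s x) := by
  by_cases hL : ∃ x ∈ C, 1/2 < s x
  · obtain ⟨x, hx, hlt⟩ := hL
    calc (1 : ℝ) = itemWeight (s x) := by rw [itemWeight, if_pos hlt]
      _ ≤ _ := single_le_sum (f := fun x => itemWeight (s x))
          (fun y _ => itemWeight_nonneg (h0 y)) hx
  · push Not at hL
    have := sum_le_sum fun x hx => four_thirds_mul_le_itemWeight (hL x hx)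
    rw [← mul_sum] at this
    linarith

namespace Packable

variable {ι : Type*} {s : ι → ℝ} {C D : Finset ι} {t : ℕ}

theorem of_sum_le_one (h : ∑ x ∈ C, s x ≤ 1) : Packable s C 1 := by
  refine ⟨fun _ => 0, by simp, fun i => ?_⟩
  by_cases hi : 0 = i
  · simpa [hi] using h
  · simp [hi]

theorem union (hC : Packable s C t) (hCD : Disjoint C D) (hD : ∑ x ∈ D, s x ≤ 1) :
    Packable s (C ∪ D) (t + 1) := by
  obtain ⟨f, hf, hs⟩ := hC
  have hnot : ∀ x ∈ C, x ∉ D := fun x hx => disjoint_left.mp hCD hx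
  refine ⟨fun x => if x ∈ D then t else f x, fun x hx => ?_, fun i => ?_⟩
  · dsimp only
    split_ifs with h
    · omega
    · have := hf x ((mem_union.mp hx).resolve_right h)
      omega
  · by_cases hi : i = t
    · have : {x ∈ C ∪ D | (if x ∈ D then t else f x) = i} = D := by
        ext x
        have := hf x
        have := hnot x
        simp only [mem_filter, mem_union]
        split_ifs <;> grind
      rw [this]
      exact hD
    · have : {x ∈ C ∪ D | (if x ∈ D then t else f x) = i} = {x ∈ C | f x = i} := by
        ext x
        have := hnot x
        simp only [mem_filter, mem_union]
        split_ifs <;> grind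
      rw [this]
      exact hs i

/-- A small item either fits into one of the bins, or all bins are so full that a new one can be
afforded. -/
theorem exists_insert (h0 : ∀ x, 0 ≤ s x) {x : ι} (hxC : x ∉ C) (hx : s x ≤ 1/4)
    (hC : Packable s C t) (ht : t ≤ ∑ y ∈ C, itemWeight (s y) + 1) :
    ∃ t' : ℕ, Packable s (insert x C) t' ∧
      t' ≤ ∑ y ∈ insert x C, itemWeight (s y) + 1 := by
  have hw := itemWeight_nonneg (h0 x)
  rw [sum_insert hxC]
  obtain ⟨f, hf, hs⟩ := id hC
  by_cases hfit : ∃ i < t, ∑ y ∈ C with f y = i, s y ≤ 3/4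
  · obtain ⟨i, hi, hfit⟩ := hfit
    refine ⟨t, ⟨Function.update f x i, fun y hy => ?_, fun j => ?_⟩, by linarith⟩
    · rcases eq_or_ne y x with rfl | hne
      · simpa using hi
      · simpa [hne] using hf y (mem_of_mem_insert_of_ne hy hne)
    · have hfilter : {y ∈ C | Function.update f x i y = j} = {y ∈ C | f y = j} :=
        filter_congr fun y hy => by
          rw [Function.update_of_ne (ne_of_mem_of_not_mem hy hxC)]
      rw [filter_insert, hfilter, Function.update_self]
      split_ifs with hij
      · rw [sum_insert fun h => hxC (mem_filter.mp h).1, ← hij]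
        linarith
      · exact hs j
  · push Not at hfit
    refine ⟨t + 1, ?_, ?_⟩
    · rw [insert_eq, union_comm]
      exact hC.union (disjoint_singleton_right.mpr hxC) (by simpa using by linarith)
    · have hfib := sum_fiberwise_of_maps_to (s := C) (t := range t) (g := f)
        (fun y hy => mem_range.mpr (hf y hy)) (fun y => itemWeight (s y))
      have hle : ∑ _i ∈ range t, (1 : ℝ) ≤
          ∑ i ∈ range t, ∑ y ∈ C with f y = i, itemWeight (s y) :=
        sum_le_sum fun i hi => one_le_sum_itemWeight h0 (hfit i (mem_range.mp hi)).le
      rw [hfib] at hle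
      simp only [sum_const, card_range, nsmul_eq_mul, mul_one] at hle
      push_cast
      linarith

end Packable

theorem exists_packable_le_sum_itemWeight {ι : Type*} {s : ι → ℝ}
    (hs : ∀ x, s x ∈ Set.Icc (0 : ℝ) 1) (C : Finset ι) :
    ∃ t : ℕ, Packable s C t ∧ t ≤ ∑ x ∈ C, itemWeight (s x) + 1 := by
  have h0 : ∀ x, 0 ≤ s x := fun x => (hs x).1
  induction C using Finset.strongInduction with
  | H C ih =>
  have remove : ∀ D ⊆ C, ∑ x ∈ D, s x ≤ 1 → 1 ≤ ∑ x ∈ D, itemWeight (s x) →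
      ∃ t : ℕ, Packable s C t ∧ t ≤ ∑ x ∈ C, itemWeight (s x) + 1 := by
    intro D hD h1 hw
    have hne : D.Nonempty := by
      rw [nonempty_iff_ne_empty]
      rintro rfl
      norm_num at hw
    obtain ⟨t, ht, hle⟩ := ih (C \ D) (sdiff_ssubset hD hne)
    refine ⟨t + 1, ?_, ?_⟩
    · simpa [sdiff_union_of_subset hD] using ht.union sdiff_disjoint h1
    · rw [← sum_sdiff hD]
      push_cast
      linarith
  by_cases htiny : ∃ x ∈ C, s x ≤ 1/4
  · obtain ⟨x, hx, hx4⟩ := htiny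
    obtain ⟨t, ht, hle⟩ := ih (C.erase x) (erase_ssubset hx)
    simpa [insert_erase hx] using ht.exists_insert h0 (notMem_erase x C) hx4 hle
  by_cases hlarge : ∃ x ∈ C, 1/2 < s x
  · obtain ⟨x, hx, hx2⟩ := hlarge
    exact remove {x} (by simpa using hx) (by simpa using (hs x).2) (by rw [sum_singleton, itemWeight, if_pos hx2])
  push Not at htiny hlarge
  set M := {x ∈ C | 1/3 < s x}
  set A := {x ∈ C | ¬ 1/3 < s x}
  have sum_le : ∀ (D : Finset ι) (k : ℕ) (b : ℝ), D.card = k → (∀ x ∈ D, s x ≤ b) →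
      ∑ x ∈ D, s x ≤ k * b := by
    intro D k b hk h
    simpa [hk] using sum_le_card_nsmul D s b h
  have le_sum : ∀ (D : Finset ι) (k : ℕ) (b : ℝ), D.card = k →
      (∀ x ∈ D, b ≤ itemWeight (s x)) → k * b ≤ ∑ x ∈ D, itemWeight (s x) := by
    intro D k b hk h
    simpa [hk] using card_nsmul_le_sum D (fun x => itemWeight (s x)) b h
  have hMs : ∀ x ∈ M, s x ≤ 1/2 := fun x hx => hlarge x (mem_filter.mp hx).1
  have hAs : ∀ x ∈ A, s x ≤ 1/3 := fun x hx => not_lt.mp (mem_filter.mp hx).2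
  by_cases hM2 : 2 ≤ M.card
  · obtain ⟨D, hD, hcard⟩ := exists_subset_card_eq hM2
    refine remove D (hD.trans (filter_subset _ _)) ?_ ?_
    · exact (sum_le D 2 (1/2) hcard fun x hx => hMs x (hD hx)).trans (by norm_num)
    · refine le_trans (by norm_num) (le_sum D 2 (1/2) hcard fun x hx => ?_)
      have h3 := (mem_filter.mp (hD hx)).2
      rw [itemWeight, if_neg (hMs x (hD hx)).not_gt, if_pos h3]
      linarith
  by_cases hA3 : 3 ≤ A.card
  · obtain ⟨D, hD, hcard⟩ := exists_subset_card_eq hA3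
    refine remove D (hD.trans (filter_subset _ _)) ?_ ?_
    · exact (sum_le D 3 (1/3) hcard fun x hx => hAs x (hD hx)).trans (by norm_num)
    · refine le_trans (by norm_num) (le_sum D 3 (1/3) hcard fun x hx => ?_)
      have h3 := hAs x (hD hx)
      have h4 := htiny x (mem_filter.mp (hD hx)).1
      have := four_thirds_mul_le_itemWeight (r := s x) (by linarith)
      linarith
  by_cases hone : ∑ x ∈ C, s x ≤ 1
  · refine ⟨1, .of_sum_le_one hone, ?_⟩
    have := sum_nonneg fun x (_ : x ∈ C) => itemWeight_nonneg (h0 x)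
    push_cast
    linarith
  · refine ⟨2, ?_, ?_⟩
    · have hMc : (M.card : ℝ) ≤ 1 := by exact_mod_cast (by omega : M.card ≤ 1)
      have hAc : (A.card : ℝ) ≤ 2 := by exact_mod_cast (by omega : A.card ≤ 2)
      have hMsum := sum_le M _ _ rfl hMs
      have hAsum := sum_le A _ _ rfl hAs
      rw [← filter_union_filter_not_eq (fun x => 1/3 < s x) C]
      exact (Packable.of_sum_le_one (by linarith)).union
        (disjoint_filter_filter_not _ _ _) (by linarith)
    · have := one_le_sum_itemWeight h0 (C := C) (by linarith)
      push_cast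
      linarith

/-- For every bin packing instance `(I, s)` with `s : I → [0,1]`, there exists a
packing of `I` into `t` bins such that `t ≤ |L| + (3/2)·s(M) + (4/3)·s(S) + 1`, where `L` are the
large items (size `> 1/2`), `M` the medium items (size in `(1/3, 1/2]`) and `S` the small items
(size `≤ 1/3`). -/
theorem stmt_1 {ι : Type*} [Fintype ι]
    (s : ι → ℝ) (hs : ∀ x, s x ∈ Set.Icc (0 : ℝ) 1) :
    ∃ (t : ℕ) (B : Fin t → Finset ι),
      (∀ x : ι, ∃! i, x ∈ B i) ∧
      (∀ i, ∑ x ∈ B i, s x ≤ 1) ∧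
      (t : ℝ) ≤ ((univ.filter fun x => 1/2 < s x).card : ℝ)
        + 3/2 * ∑ x ∈ univ.filter (fun x => 1/3 < s x ∧ s x ≤ 1/2), s x
        + 4/3 * ∑ x ∈ univ.filter (fun x => s x ≤ 1/3), s x + 1 := by
  obtain ⟨t, ⟨f, hf, hsum⟩, ht⟩ := exists_packable_le_sum_itemWeight hs univ
  refine ⟨t, fun i => {x | f x = i}, fun x => ?_, fun i => hsum i, ?_⟩
  · refine ⟨⟨f x, hf x (mem_univ x)⟩, by simp, fun i hi => ?_⟩
    exact Fin.ext (mem_filter.mp hi).2.symm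
  · refine ht.trans_eq ?_
    rw [card_eq_sum_ones, Nat.cast_sum, mul_sum, mul_sum, sum_filter, sum_filter, sum_filter,
      ← sum_add_distrib, ← sum_add_distrib]
    congr 1
    refine sum_congr rfl fun x _ => ?_
    unfold itemWeight
    split_ifs <;> grind
end

section
/- For every bin packing instance (I, s) with s : I → [0,1] and total size s(I) ≤ 3/2, there exists a packing of I into at most 2 bins. -/
open Finset

/-- Items of size at most `1` and total size at most `3/2` split into two parts of size at most
`1`. -/
lemma exists_sum_le_one_and_sum_compl_le_one {ι : Type*} [Fintype ι] [DecidableEq ι]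
    (s : ι → ℝ) (hs : ∀ x, s x ≤ 1) (hI : ∑ x, s x ≤ 3/2) :
    ∃ A : Finset ι, ∑ x ∈ A, s x ≤ 1 ∧ ∑ x ∈ Aᶜ, s x ≤ 1 := by
  obtain ⟨A, hA⟩ := (Set.toFinite {A : Finset ι | ∑ x ∈ A, s x ≤ 1}).exists_maximal ⟨∅, by simp⟩
  by_cases hc : ∑ x ∈ Aᶜ, s x ≤ 1
  · exact ⟨A, hA.prop, hc⟩
  have hsum := sum_add_sum_compl A s
  obtain ⟨x, hx⟩ : Aᶜ.Nonempty := by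
    rw [nonempty_iff_ne_empty]
    intro h
    simp [h] at hc
  rw [mem_compl] at hx
  have hins : 1 < ∑ y ∈ insert x A, s y := by
    by_contra! h
    exact hx (hA.le_of_ge h (subset_insert x A) (mem_insert_self x A))
  rw [sum_insert hx] at hins
  have hsingle := sum_add_sum_compl {x} s
  rw [sum_singleton] at hsingle
  refine ⟨{x}, by simpa using hs x, by linarith⟩

/-- For every bin packing instance `(I, s)` with `s : I → [0,1]` and total size
`s(I) ≤ 3/2`, there exists a packing of `I` into at most `2` bins. -/
theorem stmt_3 {ι : Type*} [Fintype ι]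
    (s : ι → ℝ) (hs : ∀ x, s x ∈ Set.Icc (0 : ℝ) 1)
    (hI : ∑ x, s x ≤ 3/2) :
    ∃ t : ℕ, t ≤ 2 ∧ ∃ B : Fin t → Finset ι,
      (∀ x : ι, ∃! i, x ∈ B i) ∧
      (∀ i, ∑ x ∈ B i, s x ≤ 1) := by
  classical
  obtain ⟨A, hA, hAc⟩ := exists_sum_le_one_and_sum_compl_le_one s (fun x => (hs x).2) hI
  refine ⟨2, le_rfl, ![A, Aᶜ], fun x => ?_, ?_⟩
  · by_cases hx : x ∈ A
    · exact ⟨0, by simpa using hx, by simp [Fin.forall_fin_two, hx]⟩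
    · exact ⟨1, by simpa using hx, by simp [Fin.forall_fin_two, hx]⟩
  · simpa [Fin.forall_fin_two] using ⟨hA, hAc⟩
end

section
/- Let (I, s) be a bin packing instance with s : I → [0,1], let ε be a real number with 0 < ε < 0.1, let T = {ℓ ∈ I : s(ℓ) ≤ ε} be the tiny items and B = I \ T the big items. If s(T) > 1 and s(B) < 2, then there exists a packing of I into t bins such that (1 − ε)·(t − 1) ≤ s(I). -/
open Finset
open scoped Classical

/-- The colouring `f` packs the items of `S` into bins `0, …, t - 1` of capacity one. -/
def IsPacking {ι : Type*} (s : ι → ℝ) (S : Finset ι) (t : ℕ) (f : ι → ℕ) : Prop :=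
  (∀ x ∈ S, f x < t) ∧ ∀ i, ∑ x ∈ S with f x = i, s x ≤ 1

/-- Recolouring a new item `x` as `j` only adds `s x` to the load of bin `j`. -/
lemma sum_filter_insert_update {ι : Type*} (s : ι → ℝ) {S : Finset ι} {x : ι} (hx : x ∉ S)
    (f : ι → ℕ) (i j : ℕ) :
    ∑ y ∈ insert x S with Function.update f x j y = i, s y =
      (if j = i then s x else 0) + ∑ y ∈ S with f y = i, s y := by
  rw [sum_filter, sum_insert hx, sum_filter, Function.update_self]
  congr 1
  refine sum_congr rfl fun y hy => ?_
  rw [Function.update_of_ne (ne_of_mem_of_not_mem hy hx)]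

lemma IsPacking.insert {ι : Type*} {s : ι → ℝ} {S : Finset ι} {t t' j : ℕ} {f : ι → ℕ}
    (hf : IsPacking s S t f) {x : ι} (hx : x ∉ S) (htt : t ≤ t') (hj : j < t')
    (hload : s x + ∑ y ∈ S with f y = j, s y ≤ 1) :
    IsPacking s (insert x S) t' (Function.update f x j) := by
  refine ⟨fun y hy => ?_, fun i => ?_⟩
  · by_cases hyx : y = x
    · simpa [hyx] using hj
    · rw [Function.update_of_ne hyx]
      exact (hf.1 y (mem_of_mem_insert_of_ne hy hyx)).trans_le htt
  · rw [sum_filter_insert_update s hx]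
    split_ifs with h
    · exact h ▸ hload
    · simpa using hf.2 i

lemma IsPacking.sum_load {ι : Type*} {s : ι → ℝ} {S : Finset ι} {t : ℕ} {f : ι → ℕ}
    (hf : IsPacking s S t f) :
    ∑ i ∈ range t, ∑ y ∈ S with f y = i, s y = ∑ y ∈ S, s y :=
  sum_fiberwise_of_maps_to (fun x hx => mem_range.2 (hf.1 x hx)) s

/-- An empty bin accepts any single item. -/
lemma IsPacking.insert_new {ι : Type*} {s : ι → ℝ} {S : Finset ι} {t : ℕ} {f : ι → ℕ}
    (hf : IsPacking s S t f) {x : ι} (hx : x ∉ S) (hsx : s x ≤ 1) :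
    IsPacking s (Insert.insert x S) (t + 1) (Function.update f x t) := by
  refine hf.insert hx t.le_succ t.lt_succ_self ?_
  rw [filter_false_of_mem fun y hy => (hf.1 y hy).ne]
  simpa using hsx

/-- Items of total size less than two fit into three bins. -/
lemma exists_isPacking_three {ι : Type*} {s : ι → ℝ} (hs : ∀ x, s x ∈ Set.Icc (0 : ℝ) 1)
    (S : Finset ι) (hS : ∑ x ∈ S, s x < 2) : ∃ f, IsPacking s S 3 f := by
  induction S using Finset.induction_on with
  | empty => exact ⟨0, by simp [IsPacking]⟩
  | insert x S hx ih =>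
    rw [sum_insert hx] at hS
    obtain ⟨f, hf⟩ := ih (by linarith [(hs x).1])
    by_cases h0 : s x + ∑ y ∈ S with f y = 0, s y ≤ 1
    · exact ⟨_, hf.insert hx le_rfl (by norm_num) h0⟩
    · have hrest := sum_filter_add_sum_filter_not S (fun y => f y = 0) s
      have hg : IsPacking s S 2 (fun y => if f y = 0 then 0 else 1) := by
        refine ⟨fun y _ => by dsimp only; split_ifs <;> norm_num, fun i => ?_⟩
        rcases i with _ | _ | i
        · simpa using hf.2 0
        · have : ∑ y ∈ S with ¬ f y = 0, s y ≤ 1 := by linarith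
          simpa using this
        · rw [filter_false_of_mem fun y _ => by dsimp only; split_ifs <;> simp]
          simp
      exact ⟨_, hg.insert_new hx (hs x).2⟩

/-- Greedily adding tiny items to a packing opens a new bin only once all others are nearly
full. -/
lemma IsPacking.exists_union {ι : Type*} {s : ι → ℝ} (hs : ∀ x, s x ∈ Set.Icc (0 : ℝ) 1)
    {ε : ℝ} {S T : Finset ι} {t₀ : ℕ} {f₀ : ι → ℕ} (h₀ : IsPacking s S t₀ f₀)
    (hT : ∀ x ∈ T, s x ≤ ε) :
    ∃ t f, IsPacking s (T ∪ S) t f ∧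
      (t = t₀ ∨ (1 - ε) * ((t : ℝ) - 1) ≤ ∑ x ∈ T ∪ S, s x) := by
  induction T using Finset.induction_on with
  | empty => exact ⟨t₀, f₀, by simpa using h₀, Or.inl rfl⟩
  | insert x T _ ih =>
    obtain ⟨t, f, hf, ht⟩ := ih fun y hy => hT y (mem_insert_of_mem hy)
    rw [insert_union]
    by_cases hx : x ∈ T ∪ S
    · rw [insert_eq_of_mem hx]
      exact ⟨t, f, hf, ht⟩
    rw [sum_insert hx]
    have hx0 := (hs x).1
    by_cases hfit : ∃ j < t, ∑ y ∈ T ∪ S with f y = j, s y ≤ 1 - ε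
    · obtain ⟨j, hj, hload⟩ := hfit
      refine ⟨t, _, hf.insert hx le_rfl hj ?_, ht.imp_right fun h => by linarith⟩
      linarith [hT x (mem_insert_self x T)]
    · push Not at hfit
      refine ⟨t + 1, _, hf.insert_new hx (hs x).2, Or.inr ?_⟩
      have hfull := card_nsmul_le_sum (range t) (fun j => ∑ y ∈ T ∪ S with f y = j, s y) (1 - ε)
        fun j hj => (hfit j (mem_range.1 hj)).le
      rw [hf.sum_load, card_range, nsmul_eq_mul] at hfull
      push_cast
      linarith

/-- Let `(I, s)` be a bin packing instance with `s : I → [0,1]`, let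
`0 < ε < 0.1`, let `T = {ℓ ∈ I : s(ℓ) ≤ ε}` be the tiny items and `B = I \ T` the big items.
If `s(T) > 1` and `s(B) < 2`, then there exists a packing of `I` into `t` bins such that
`(1 − ε)·(t − 1) ≤ s(I)`. -/
theorem stmt_4 {ι : Type*} [Fintype ι]
    (s : ι → ℝ) (hs : ∀ x, s x ∈ Set.Icc (0 : ℝ) 1)
    (ε : ℝ) (hε : 0 < ε) (hε' : ε < 0.1)
    (hT : 1 < ∑ x ∈ univ.filter (fun x => s x ≤ ε), s x)
    (hB : ∑ x ∈ univ.filter (fun x => ε < s x), s x < 2) :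
    ∃ (t : ℕ) (B : Fin t → Finset ι),
      (∀ x : ι, ∃! i, x ∈ B i) ∧
      (∀ i, ∑ x ∈ B i, s x ≤ 1) ∧
      (1 - ε) * ((t : ℝ) - 1) ≤ ∑ x, s x := by
  set S := univ.filter (fun x => ε < s x) with hSdef
  set T := univ.filter (fun x => s x ≤ ε) with hTdef
  have hunion : T ∪ S = univ := by
    ext x
    simp [hSdef, hTdef, le_or_gt]
  have hdisj : Disjoint T S :=
    disjoint_filter.2 fun x _ h => not_lt.2 h
  have hsum : ∑ x, s x = ∑ x ∈ T, s x + ∑ x ∈ S, s x := by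
    rw [← hunion, sum_union hdisj]
  have hS0 : 0 ≤ ∑ x ∈ S, s x := sum_nonneg fun x _ => (hs x).1
  obtain ⟨t₀, f₀, h₀, ht₀, ht₀'⟩ : ∃ t₀ f₀, IsPacking s S t₀ f₀ ∧
      1 ≤ t₀ ∧ (t₀ : ℝ) - 2 ≤ ∑ x ∈ S, s x := by
    by_cases h1 : ∑ x ∈ S, s x ≤ 1
    · refine ⟨1, 0, ⟨by simp, fun i => ?_⟩, le_rfl, by push_cast; linarith⟩
      exact (sum_le_sum_of_subset_of_nonneg (filter_subset _ _) fun x _ _ => (hs x).1).trans h1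
    · obtain ⟨f₀, h₀⟩ := exists_isPacking_three hs S hB
      exact ⟨3, f₀, h₀, by norm_num, by push_cast; linarith⟩
  obtain ⟨t, f, hf, ht⟩ := h₀.exists_union hs (ε := ε) (T := T) (by simp [hTdef])
  rw [hunion] at hf ht
  refine ⟨t, fun i => univ.filter (fun x => f x = i), fun x => ?_, fun i => hf.2 i, ?_⟩
  · exact ⟨⟨f x, hf.1 x (mem_univ x)⟩, by simp, fun i hi => Fin.ext (mem_filter.1 hi).2.symm⟩
  · rcases ht with rfl | h
    · have : (1 : ℝ) ≤ t := by exact_mod_cast ht₀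
      nlinarith
    · exact h
end

section
/- For every bin packing with conflicts instance (I, s, E) with conflict graph G = (I, E) that admits at least one packing, there exists a packing of I into at most OPT(I) + χ(G) + (4/3)·s(S) bins, where OPT(I) is the minimum number of bins in a packing of I, χ(G) is the chromatic number of G, and S = {ℓ ∈ I : s(ℓ) ≤ 1/3}. -/
open Finset
open scoped Classical

/-- If all items of `A` have size at most `1/3` and the total size exceeds `1`, then some
subset of `A` fits in a unit bin and fills at least three quarters of it. -/
theorem exists_subset_three_quarters_le_sum {ι : Type*} (s : ι → ℝ) (A : Finset ι)
    (h3 : ∀ x ∈ A, s x ≤ 1 / 3) (hA : 1 < ∑ x ∈ A, s x) :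
    ∃ C ⊆ A, 3 / 4 ≤ ∑ x ∈ C, s x ∧ ∑ x ∈ C, s x ≤ 1 := by
  by_cases hM : 3 ≤ #(A.filter fun x => 1 / 4 < s x)
  · obtain ⟨C, hC, hcard⟩ := exists_subset_card_eq hM
    refine ⟨C, hC.trans (filter_subset _ _), ?_, ?_⟩
    · have := card_nsmul_le_sum C s (1 / 4) fun x hx => (mem_filter.1 (hC hx)).2.le
      rw [hcard] at this
      norm_num at this ⊢
      linarith
    · have := sum_le_card_nsmul C s (1 / 3) fun x hx => h3 x (mem_filter.1 (hC hx)).1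
      rw [hcard] at this
      norm_num at this ⊢
      linarith
  · set M := A.filter fun x => 1 / 4 < s x
    have hM1 : ∑ x ∈ M, s x ≤ 1 := by
      have h := sum_le_card_nsmul M s (1 / 3) fun x hx => h3 x (mem_filter.1 hx).1
      have h2 : (#M : ℝ) ≤ 2 := by exact_mod_cast (by omega : #M ≤ 2)
      rw [nsmul_eq_mul] at h
      linarith
    obtain ⟨C, hC, hmax⟩ := exists_max_image
      (A.powerset.filter fun C => M ⊆ C ∧ ∑ x ∈ C, s x ≤ 1) card
      ⟨M, mem_filter.2 ⟨mem_powerset.2 (filter_subset _ _), Subset.rfl, hM1⟩⟩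
    simp only [mem_filter, mem_powerset] at hC hmax
    obtain ⟨hCA, hMC, hC1⟩ := hC
    refine ⟨C, hCA, ?_, hC1⟩
    obtain ⟨x, hxA, hxC⟩ : ∃ x ∈ A, x ∉ C := by
      by_contra! h
      rw [hCA.antisymm h] at hC1
      linarith
    have hx : s x ≤ 1 / 4 := by
      by_contra! h
      exact hxC (hMC (mem_filter.2 ⟨hxA, h⟩))
    by_contra! h
    have := hmax (insert x C) ⟨insert_subset hxA hCA, hMC.trans (subset_insert _ _), by
      rw [sum_insert hxC]; linarith⟩
    rw [card_insert_of_notMem hxC] at this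
    omega

/-- Items of size at most `1/3` can be packed into at most `1 + (4/3)·s(A)` unit bins. -/
theorem exists_packing_of_le_third {ι : Type*} (s : ι → ℝ) (A : Finset ι)
    (h0 : ∀ x ∈ A, 0 ≤ s x) (h3 : ∀ x ∈ A, s x ≤ 1 / 3) :
    ∃ (m : ℕ) (f : ι → Fin (m + 1)), (∀ i, ∑ x ∈ A with f x = i, s x ≤ 1) ∧
      (m : ℝ) ≤ 4 / 3 * ∑ x ∈ A, s x := by
  induction A using Finset.strongInduction with
  | H A ih =>
    by_cases hA : ∑ x ∈ A, s x ≤ 1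
    · refine ⟨0, fun _ => 0, fun i => ?_, ?_⟩
      · exact (sum_le_sum_of_subset_of_nonneg (filter_subset _ _)
          fun x hx _ => h0 x hx).trans hA
      · have := sum_nonneg h0
        push_cast
        linarith
    · obtain ⟨C, hCA, hC, hC1⟩ :=
        exists_subset_three_quarters_le_sum s A h3 (not_le.1 hA)
      have hne : C.Nonempty := by
        rw [nonempty_iff_ne_empty]
        rintro rfl
        norm_num at hC
      obtain ⟨m, f, hf, hm⟩ := ih (A \ C) (sdiff_ssubset hCA hne)
        (fun x hx => h0 x (mem_sdiff.1 hx).1) (fun x hx => h3 x (mem_sdiff.1 hx).1)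
      refine ⟨m + 1, fun x => if x ∈ C then 0 else (f x).succ, fun i => ?_, ?_⟩
      · cases i using Fin.cases with
        | zero =>
          convert hC1 using 2
          ext x
          have := @hCA x
          by_cases hx : x ∈ C <;> simp_all [Fin.succ_ne_zero]
        | succ j =>
          convert hf j using 2
          ext x
          by_cases hx : x ∈ C <;> simp [hx, (Fin.succ_ne_zero _).symm]
      · have := sum_sdiff (f := s) hCA
        push_cast
        linarith

/-- For every bin packing with conflicts instance `(I, s, E)` with conflict graph
`G = (I, E)` that admits at least one packing, there exists a packing of `I` into at most
`OPT(I) + χ(G) + (4/3)·s(S)` bins, where `OPT(I)` is the minimum number of bins of a packing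
and `S = {ℓ ∈ I : s(ℓ) ≤ 1/3}`. -/
theorem stmt_6 {ι : Type*} [Fintype ι]
    (s : ι → ℝ) (hs : ∀ x, s x ∈ Set.Icc (0 : ℝ) 1)
    (G : SimpleGraph ι) (k : ℕ) (hk : G.chromaticNumber = (k : ℕ∞))
    (opt : ℕ)
    (hopt : IsLeast {t : ℕ | ∃ B : Fin t → Finset ι,
      (∀ x : ι, ∃! i, x ∈ B i) ∧
      (∀ i, ∀ u ∈ B i, ∀ v ∈ B i, ¬ G.Adj u v) ∧
      (∀ i, ∑ x ∈ B i, s x ≤ 1)} opt) :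
    ∃ (t : ℕ) (B : Fin t → Finset ι),
      (∀ x : ι, ∃! i, x ∈ B i) ∧
      (∀ i, ∀ u ∈ B i, ∀ v ∈ B i, ¬ G.Adj u v) ∧
      (∀ i, ∑ x ∈ B i, s x ≤ 1) ∧
      (t : ℝ) ≤ (opt : ℝ) + (k : ℝ)
        + 4/3 * ∑ x ∈ univ.filter (fun x => s x ≤ 1/3), s x := by
  obtain ⟨B, hB, hBG, hBs⟩ := hopt.1
  choose b hb _ using hB
  obtain ⟨col⟩ : G.Colorable k := SimpleGraph.chromaticNumber_le_iff_colorable.1 hk.le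
  choose m f hf hm using fun c : Fin k =>
    exists_packing_of_le_third s (univ.filter fun x => s x ≤ 1 / 3 ∧ col x = c)
      (fun x _ => (hs x).1) (fun x hx => (mem_filter.1 hx).2.1)
  let g : ι → Fin opt ⊕ (Σ c : Fin k, Fin (m c + 1)) := fun x =>
    if s x ≤ 1 / 3 then Sum.inr ⟨col x, f (col x) x⟩ else Sum.inl (b x)
  let e := Fintype.equivFin (Fin opt ⊕ (Σ c : Fin k, Fin (m c + 1)))
  refine ⟨_, fun i => univ.filter fun x => g x = e.symm i, fun x => ⟨e (g x), ?_, ?_⟩,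
    fun i u hu v hv huv => ?_, fun i => ?_, ?_⟩
  · simp
  · intro i hi
    simp only [mem_filter, mem_univ, true_and] at hi
    simp [hi]
  · simp only [mem_filter, mem_univ, true_and] at hu hv
    have h := hu.trans hv.symm
    by_cases h1 : s u ≤ 1 / 3 <;> by_cases h2 : s v ≤ 1 / 3 <;>
      simp only [g, h1, h2, if_true, if_false, Sum.inr.injEq, Sum.inl.injEq, reduceCtorEq] at h
    · exact col.valid huv (congrArg Sigma.fst h)
    · exact hBG (b u) u (hb u) v (h ▸ hb v) huv
  · beta_reduce
    generalize e.symm i = p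
    obtain h | ⟨c, j⟩ := p
    · refine (sum_le_sum_of_subset_of_nonneg ?_ fun x _ _ => (hs x).1).trans (hBs h)
      intro x hx
      simp only [mem_filter, mem_univ, true_and, g] at hx
      split_ifs at hx
      cases hx
      exact hb x
    · refine (sum_le_sum_of_subset_of_nonneg ?_ fun x _ _ => (hs x).1).trans (hf c j)
      intro x hx
      simp only [mem_filter, mem_univ, true_and, g] at hx ⊢
      split_ifs at hx with h
      cases hx
      exact ⟨⟨h, rfl⟩, rfl⟩
  · have hsum : ∑ c : Fin k, ∑ x ∈ univ.filter (fun x => s x ≤ 1 / 3 ∧ col x = c), s x =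
        ∑ x ∈ univ.filter (fun x => s x ≤ 1 / 3), s x := by
      rw [← sum_fiberwise (univ.filter fun x => s x ≤ 1 / 3) col s]
      simp only [filter_filter]
    have := sum_le_sum fun c (_ : c ∈ univ) => hm c
    rw [← mul_sum, hsum] at this
    simp only [Fintype.card_sum, Fintype.card_sigma, Fintype.card_fin, sum_add_distrib,
      sum_const, card_univ, smul_eq_mul, mul_one]
    push_cast
    linarith
end

section
/- Let X, Y, Z be pairwise disjoint finite sets, let T ⊆ X × Y × Z, and let c ≥ 3 be an integer. Suppose every element u ∈ X ∪ Y ∪ Z appears as a coordinate of at least one triple of T and of at most c triples of T, and suppose ν(T) ≥ 5, where ν(T) is the maximum cardinality of a subset M ⊆ T in which every element of X ∪ Y ∪ Z appears in at most one triple. Then ν(T) ≥ (|X| + |Y| + |Z| + |T|)/(4·c³). -/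
open Finset
open scoped Classical

theorem exists_mem_share_of_isGreatest {α : Type*} {V : Finset α} {T : Finset (α × α × α)}
    {M : Finset (α × α × α)} (hMT : M ⊆ T)
    (hM : ∀ u ∈ V, (M.filter fun t => t.1 = u ∨ t.2.1 = u ∨ t.2.2 = u).card ≤ 1)
    (hmax : ∀ N ⊆ T, (∀ u ∈ V, (N.filter fun t => t.1 = u ∨ t.2.1 = u ∨ t.2.2 = u).card ≤ 1) →
      N.card ≤ M.card) {t : α × α × α} (ht : t ∈ T) :
    ∃ m ∈ M, ∃ u, (t.1 = u ∨ t.2.1 = u ∨ t.2.2 = u) ∧ (m.1 = u ∨ m.2.1 = u ∨ m.2.2 = u) := by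
  by_contra! h
  have htM : t ∉ M := fun htM => (h t htM t.1 (Or.inl rfl)).1 rfl
  have hle := hmax (insert t M) (insert_subset ht hMT) fun u hu => by
    rw [filter_insert]
    split_ifs with htu
    · have hempty : (M.filter fun t => t.1 = u ∨ t.2.1 = u ∨ t.2.2 = u) = ∅ :=
        filter_eq_empty_iff.2 fun m hm => by
          have := h m hm u htu
          tauto
      rw [hempty]
      simp
    · exact hM u hu
  rw [card_insert_of_notMem htM] at hle
  omega

theorem card_le_card_of_covered {α : Type*} {S : Finset α} {T : Finset (α × α × α)}
    (f : α × α × α → α) (h : ∀ u ∈ S, ∃ t ∈ T, f t = u) : S.card ≤ T.card := by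
  refine (card_le_card fun u hu => ?_).trans (card_image_le (s := T) (f := f))
  exact mem_image.2 (h u hu)

/-- Let `X, Y, Z` be pairwise disjoint finite sets, `T ⊆ X × Y × Z`, and
`c ≥ 3` an integer. If every element of `X ∪ Y ∪ Z` appears as a coordinate of at least one and at
most `c` triples of `T`, and the maximum matching size `ν(T)` satisfies `ν(T) ≥ 5`, then
`ν(T) ≥ (|X| + |Y| + |Z| + |T|) / (4·c³)`. -/
theorem stmt_11 {α : Type*} [DecidableEq α]
    (X Y Z : Finset α) (T : Finset (α × α × α))
    (hXY : Disjoint X Y) (hXZ : Disjoint X Z) (hYZ : Disjoint Y Z)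
    (hT : ∀ t ∈ T, t.1 ∈ X ∧ t.2.1 ∈ Y ∧ t.2.2 ∈ Z)
    (c : ℕ) (hc : 3 ≤ c)
    (hdeg_lo : ∀ u ∈ X ∪ Y ∪ Z,
      1 ≤ (T.filter fun t => t.1 = u ∨ t.2.1 = u ∨ t.2.2 = u).card)
    (hdeg_hi : ∀ u ∈ X ∪ Y ∪ Z,
      (T.filter fun t => t.1 = u ∨ t.2.1 = u ∨ t.2.2 = u).card ≤ c)
    (ν : ℕ)
    (hν : IsGreatest {k : ℕ | ∃ M ⊆ T,
      (∀ u ∈ X ∪ Y ∪ Z,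
        (M.filter fun t => t.1 = u ∨ t.2.1 = u ∨ t.2.2 = u).card ≤ 1) ∧
      M.card = k} ν)
    (hν5 : 5 ≤ ν) :
    ((X.card + Y.card + Z.card + T.card : ℝ)) / (4 * (c : ℝ) ^ 3) ≤ (ν : ℝ) := by
  obtain ⟨⟨M, hMT, hM, rfl⟩, hmax⟩ := hν
  have hcover : ∀ u ∈ X ∪ Y ∪ Z, ∃ t ∈ T, t.1 = u ∨ t.2.1 = u ∨ t.2.2 = u := fun u hu => by
    obtain ⟨t, ht⟩ := card_pos.1 (hdeg_lo u hu)
    exact ⟨t, mem_filter.1 ht⟩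
  rw [Finset.disjoint_left] at hXY hXZ hYZ
  have hX : X.card ≤ T.card := card_le_card_of_covered (fun t => t.1) fun u hu => by
    obtain ⟨t, ht, h⟩ := hcover u (by simp [hu])
    have := hT t ht
    grind
  have hY : Y.card ≤ T.card := card_le_card_of_covered (fun t => t.2.1) fun u hu => by
    obtain ⟨t, ht, h⟩ := hcover u (by simp [hu])
    have := hT t ht
    grind
  have hZ : Z.card ≤ T.card := card_le_card_of_covered (fun t => t.2.2) fun u hu => by
    obtain ⟨t, ht, h⟩ := hcover u (by simp [hu])
    have := hT t ht
    grind
  have hTM : T.card ≤ M.card * (c + c + c) := by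
    let F : α → Finset (α × α × α) := fun u => T.filter fun t => t.1 = u ∨ t.2.1 = u ∨ t.2.2 = u
    have hsub : T ⊆ M.biUnion fun m => F m.1 ∪ F m.2.1 ∪ F m.2.2 := fun t ht => by
      obtain ⟨m, hm, u, htu, hmu⟩ := exists_mem_share_of_isGreatest (V := X ∪ Y ∪ Z) hMT
        (fun u hu => by convert hM u (by convert hu))
        (fun N hN hN' => hmax ⟨N, hN, fun u hu => by convert hN' u (by convert hu), rfl⟩) ht
      refine mem_biUnion.2 ⟨m, hm, ?_⟩
      simp only [F, mem_union, mem_filter]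
      rcases hmu with rfl | rfl | rfl <;> tauto
    refine (card_le_card hsub).trans (card_biUnion_le_card_mul _ _ _ fun m hm => ?_)
    obtain ⟨h1, h2, h3⟩ := hT m (hMT hm)
    have hF : ∀ u ∈ X ∪ Y ∪ Z, (F u).card ≤ c := fun u hu => by convert hdeg_hi u hu
    have := hF m.1 (by simp [h1])
    have := hF m.2.1 (by simp [h2])
    have := hF m.2.2 (by simp [h3])
    have := card_union_le (F m.1 ∪ F m.2.1) (F m.2.2)
    have := card_union_le (F m.1) (F m.2.1)
    omega
  have hc3 : c + c + c ≤ c ^ 3 := by nlinarith [Nat.mul_le_mul hc hc, Nat.zero_le c]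
  have hfinal : X.card + Y.card + Z.card + T.card ≤ M.card * (4 * c ^ 3) := by
    have := Nat.mul_le_mul_left M.card hc3
    linarith
  rw [div_le_iff₀ (by positivity)]
  exact_mod_cast hfinal
end

section
/- Let A be a finite set of items with size function s : A → ℝ such that 0 < s(a) ≤ 1/3 for every a ∈ A, and suppose the total size s(A) = Σ_{a∈A} s(a) is at least 1/6. Then there exists a subset B ⊆ A with 1/6 ≤ s(B) ≤ 1/3. -/
open Finset

/-- Let `A` be a finite set of items with sizes `0 < s(a) ≤ 1/3` and total size
at least `1/6`. Then there exists `B ⊆ A` with `1/6 ≤ s(B) ≤ 1/3`. -/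
theorem stmt_13 {α : Type*} [DecidableEq α]
    (A : Finset α) (s : α → ℝ)
    (h1 : ∀ a ∈ A, 0 < s a ∧ s a ≤ 1/3)
    (h2 : 1/6 ≤ ∑ a ∈ A, s a) :
    ∃ B ⊆ A, 1/6 ≤ ∑ a ∈ B, s a ∧ ∑ a ∈ B, s a ≤ 1/3 := by
  induction A using Finset.induction_on with
  | empty => norm_num at h2
  | insert a A ha ih =>
    by_cases hA : 1/6 ≤ ∑ x ∈ A, s x
    · obtain ⟨B, hB, hs⟩ := ih (fun x hx => h1 x (mem_insert_of_mem hx)) hA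
      exact ⟨B, hB.trans (subset_insert a A), hs⟩
    · by_cases hsa : 1/6 ≤ s a
      · exact ⟨{a}, by simp, by simpa using hsa, by simpa using (h1 a (mem_insert_self a A)).2⟩
      · refine ⟨insert a A, Subset.rfl, h2, ?_⟩
        rw [sum_insert ha]
        linarith
end

section
/- For every bin packing with conflicts instance (I, s, E) with conflict graph G = (I, E), the minimum number of bins in a packing of I satisfies OPT(I) ≤ χ(G) + ⌈2·s(I)⌉, where χ(G) is the chromatic number of G and s(I) = Σ_{ℓ∈I} s(ℓ). -/
open Finset

/-- Next-fit: nonnegative item sizes at most `1` can be packed into unit bins `0, …, t`, where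
`t` plus the load of the last bin is at most twice the total size. -/
theorem exists_nextFit_packing {ι : Type*} [DecidableEq ι] (s : ι → ℝ)
    (hs : ∀ x, s x ∈ Set.Icc (0 : ℝ) 1) (A : Finset ι) :
    ∃ (t : ℕ) (f : ι → ℕ), (∀ x ∈ A, f x ≤ t) ∧
      (∀ i, ∑ x ∈ A with f x = i, s x ≤ 1) ∧
      (t : ℝ) + ∑ x ∈ A with f x = t, s x ≤ 2 * ∑ x ∈ A, s x := by
  induction A using Finset.induction_on with
  | empty => exact ⟨0, fun _ => 0, by simp, by simp, by simp⟩
  | insert a A ha ih =>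
    obtain ⟨t, f, hf, hcap, hload⟩ := ih
    have h_other : ∀ u i, ∑ x ∈ A with Function.update f a u x = i, s x
        = ∑ x ∈ A with f x = i, s x := by
      intro u i
      congr 1
      refine Finset.filter_congr fun x hx => ?_
      rw [Function.update_of_ne (ne_of_mem_of_not_mem hx ha)]
    have h_insert : ∀ u i, ∑ x ∈ insert a A with Function.update f a u x = i, s x
        = (if u = i then s a else 0) + ∑ x ∈ A with f x = i, s x := by
      intro u i
      rw [Finset.filter_insert, Function.update_self]
      split_ifs
      · rw [Finset.sum_insert (by simp [ha]), h_other]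
      · rw [h_other, zero_add]
    have h_bound : ∀ u, t ≤ u → ∀ x ∈ insert a A, Function.update f a u x ≤ u := by
      intro u hu x hx
      rcases Finset.mem_insert.1 hx with rfl | hx
      · simp
      · rw [Function.update_of_ne (ne_of_mem_of_not_mem hx ha)]
        exact (hf x hx).trans hu
    have h_nonneg := (hs a).1
    by_cases hfit : s a + ∑ x ∈ A with f x = t, s x ≤ 1
    · refine ⟨t, Function.update f a t, h_bound t le_rfl, fun i => ?_, ?_⟩
      · rw [h_insert]
        split_ifs with hi
        · exact hi ▸ hfit
        · simpa using hcap i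
      · rw [h_insert, if_pos rfl, Finset.sum_insert ha]
        linarith
    · have h_new : ∑ x ∈ A with f x = t + 1, s x = 0 := by
        rw [Finset.filter_false_of_mem, Finset.sum_empty]
        intro x hx
        have := hf x hx
        omega
      refine ⟨t + 1, Function.update f a (t + 1), h_bound _ t.le_succ, fun i => ?_, ?_⟩
      · rw [h_insert]
        split_ifs with hi
        · rw [← hi, h_new, add_zero]
          exact (hs a).2
        · simpa using hcap i
      · rw [h_insert, if_pos rfl, h_new, Finset.sum_insert ha]
        push_cast
        linarith

/-- For every bin packing with conflicts instance `(I, s, E)` with conflict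
graph `G = (I, E)`, the minimum number of bins of a packing satisfies
`OPT(I) ≤ χ(G) + ⌈2·s(I)⌉`. -/
theorem stmt_15 {ι : Type*} [Fintype ι]
    (s : ι → ℝ) (hs : ∀ x, s x ∈ Set.Icc (0 : ℝ) 1)
    (G : SimpleGraph ι) (k : ℕ) (hk : G.chromaticNumber = (k : ℕ∞)) :
    sInf {t : ℕ | ∃ B : Fin t → Finset ι,
        (∀ x : ι, ∃! i, x ∈ B i) ∧
        (∀ i, ∀ u ∈ B i, ∀ v ∈ B i, ¬ G.Adj u v) ∧
        (∀ i, ∑ x ∈ B i, s x ≤ 1)}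
      ≤ k + ⌈2 * ∑ x, s x⌉₊ := by
  classical
  obtain ⟨C⟩ := (SimpleGraph.chromaticNumber_le_iff_colorable.1 hk.le : G.Colorable k)
  choose t f hf hcap hload using fun c : Fin k =>
    exists_nextFit_packing s hs (univ.filter fun x => C x = c)
  let e := Fintype.equivFin (Σ c : Fin k, Fin (t c + 1))
  have h_card : Fintype.card (Σ c : Fin k, Fin (t c + 1)) ≤ k + ⌈2 * ∑ x, s x⌉₊ := by
    have h_class : ∀ c, (t c : ℝ) ≤ 2 * ∑ x with C x = c, s x := fun c =>
      le_of_add_le_of_nonneg_left (hload c) (Finset.sum_nonneg fun x _ => (hs x).1)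
    have h_total : ((∑ c, t c : ℕ) : ℝ) ≤ 2 * ∑ x, s x := by
      rw [← Finset.sum_fiberwise univ C s, Finset.mul_sum]
      push_cast
      exact Finset.sum_le_sum fun c _ => h_class c
    have := Nat.cast_le.1 (h_total.trans (Nat.le_ceil _))
    simp only [Fintype.card_sigma, Fintype.card_fin, Finset.sum_add_distrib, Finset.sum_const,
      Finset.card_univ, smul_eq_mul, mul_one]
    omega
  let b : ι → Σ c : Fin k, Fin (t c + 1) := fun x =>
    ⟨C x, f (C x) x, Nat.lt_succ_of_le (hf (C x) x (by simp))⟩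
  refine le_trans (Nat.sInf_le ?_) h_card
  refine ⟨fun i => univ.filter fun x => e (b x) = i, ?_, ?_, ?_⟩
  · intro x
    exact ⟨e (b x), by simp, fun i hi => (Finset.mem_filter.1 hi).2.symm⟩
  · intro i u hu v hv huv
    simp only [Finset.mem_filter, Finset.mem_univ, true_and] at hu hv
    exact C.valid huv (congrArg Sigma.fst (e.injective (hu.trans hv.symm)))
  · intro i
    obtain ⟨⟨c, j⟩, rfl⟩ := e.surjective i
    refine (Finset.sum_le_sum_of_subset_of_nonneg ?_ fun x _ _ => (hs x).1).trans (hcap c j)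
    intro x hx
    simp only [Finset.mem_filter, Finset.mem_univ, true_and, e.injective.eq_iff] at hx ⊢
    have hc : C x = c := congrArg Sigma.fst hx
    subst hc
    exact ⟨rfl, congrArg Fin.val (eq_of_heq (Sigma.mk.inj hx).2)⟩
end

section
/- Let (I, s, E) be a bin packing with conflicts instance whose conflict graph G = (I, E) is a split graph, i.e., its vertex set partitions into a clique K and an independent set S. Then |K| ≤ OPT(I) ≤ |K| + 1 + ⌈2·s(I)⌉, where OPT(I) is the minimum number of bins in a packing of I and s(I) = Σ_{ℓ∈I} s(ℓ). -/
open Finset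

/-- A set of items of size at most `1` whose total size exceeds `1/2` has a subset of total size
in `(1/2, 1]`. -/
theorem exists_subset_half_lt_sum_le_one {ι : Type*} [DecidableEq ι] (s : ι → ℝ)
    (hs : ∀ x, s x ≤ 1) (A : Finset ι) (hA : 1 / 2 < ∑ x ∈ A, s x) :
    ∃ T ⊆ A, 1 / 2 < ∑ x ∈ T, s x ∧ ∑ x ∈ T, s x ≤ 1 := by
  induction A using Finset.induction_on with
  | empty => norm_num at hA
  | insert a A ha ih =>
    rw [sum_insert ha] at hA
    by_cases hlt : 1 / 2 < ∑ x ∈ A, s x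
    · obtain ⟨T, hT, h⟩ := ih hlt
      exact ⟨T, hT.trans (subset_insert a A), h⟩
    by_cases hle : s a + ∑ x ∈ A, s x ≤ 1
    · exact ⟨insert a A, Subset.rfl, by rwa [sum_insert ha], by rwa [sum_insert ha]⟩
    · refine ⟨{a}, by simp, ?_, by simpa using hs a⟩
      rw [sum_singleton]
      linarith

/-- Without conflicts, items of total size `σ` can be packed into bins `0, …, t` of capacity `1`
with `t ≤ 2σ`. -/
theorem exists_packing_le_two_mul_sum {ι : Type*} [DecidableEq ι] (s : ι → ℝ)
    (hs : ∀ x, s x ∈ Set.Icc (0 : ℝ) 1) (A : Finset ι) :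
    ∃ (t : ℕ) (f : ι → ℕ), (t : ℝ) ≤ 2 * ∑ x ∈ A, s x ∧ (∀ x ∈ A, f x ≤ t) ∧
      ∀ i, ∑ x ∈ A with f x = i, s x ≤ 1 := by
  induction A using Finset.strongInduction with
  | H A ih =>
    by_cases hA : 1 / 2 < ∑ x ∈ A, s x
    · obtain ⟨T, hTA, hT, hT1⟩ := exists_subset_half_lt_sum_le_one s (fun x => (hs x).2) A hA
      have hne : T.Nonempty := by
        rw [nonempty_iff_ne_empty]
        rintro rfl
        norm_num at hT
      obtain ⟨t, f, ht, hft, hf⟩ := ih (A \ T) (sdiff_ssubset hTA hne)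
      refine ⟨t + 1, fun x => if x ∈ T then 0 else f x + 1, ?_, ?_, ?_⟩
      · have := sum_sdiff (f := s) hTA
        push_cast
        linarith
      · intro x hx
        by_cases hxT : x ∈ T
        · simp [hxT]
        · simpa [hxT] using hft x (mem_sdiff.2 ⟨hx, hxT⟩)
      · rintro (_ | i)
        · convert hT1 using 2
          grind
        · convert hf i using 2
          grind
    · refine ⟨0, fun _ => 0, ?_, by simp, fun i => ?_⟩
      · simpa using sum_nonneg fun x _ => (hs x).1
      · have := sum_le_sum_of_subset_of_nonneg (filter_subset (fun _ => 0 = i) A)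
          (fun x _ _ => (hs x).1)
        linarith

/-- Let `(I, s, E)` be a bin packing with conflicts instance whose conflict
graph `G = (I, E)` is a split graph: its vertex set partitions into a clique `K` and an
independent set `S`. Then `|K| ≤ OPT(I) ≤ |K| + 1 + ⌈2·s(I)⌉`. -/
theorem stmt_16 {ι : Type*} [Fintype ι] [DecidableEq ι]
    (s : ι → ℝ) (hs : ∀ x, s x ∈ Set.Icc (0 : ℝ) 1)
    (G : SimpleGraph ι)
    (K S : Finset ι) (hcover : K ∪ S = univ) (hdisj : Disjoint K S)
    (hK : ∀ u ∈ K, ∀ v ∈ K, u ≠ v → G.Adj u v)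
    (hS : ∀ u ∈ S, ∀ v ∈ S, ¬ G.Adj u v) :
    K.card ≤ sInf {t : ℕ | ∃ B : Fin t → Finset ι,
        (∀ x : ι, ∃! i, x ∈ B i) ∧
        (∀ i, ∀ u ∈ B i, ∀ v ∈ B i, ¬ G.Adj u v) ∧
        (∀ i, ∑ x ∈ B i, s x ≤ 1)} ∧
    sInf {t : ℕ | ∃ B : Fin t → Finset ι,
        (∀ x : ι, ∃! i, x ∈ B i) ∧
        (∀ i, ∀ u ∈ B i, ∀ v ∈ B i, ¬ G.Adj u v) ∧
        (∀ i, ∑ x ∈ B i, s x ≤ 1)}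
      ≤ K.card + 1 + ⌈2 * ∑ x, s x⌉₊ := by
  set P := {t : ℕ | ∃ B : Fin t → Finset ι,
    (∀ x : ι, ∃! i, x ∈ B i) ∧
    (∀ i, ∀ u ∈ B i, ∀ v ∈ B i, ¬ G.Adj u v) ∧
    (∀ i, ∑ x ∈ B i, s x ≤ 1)}
  have hmem : K.card + 1 + ⌈2 * ∑ x, s x⌉₊ ∈ P := by
    obtain ⟨t, f, ht, hft, hf⟩ := exists_packing_le_two_mul_sum s hs S
    have htn : t ≤ ⌈2 * ∑ x, s x⌉₊ := by
      have hSs : ∑ x ∈ S, s x ≤ ∑ x, s x :=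
        sum_le_sum_of_subset_of_nonneg (subset_univ S) (fun x _ _ => (hs x).1)
      have := Nat.le_ceil (2 * ∑ x, s x)
      exact_mod_cast (by linarith : (t : ℝ) ≤ (⌈2 * ∑ x, s x⌉₊ : ℝ))
    have hcov : ∀ x, x ∉ K → x ∈ S := fun x hx =>
      (mem_union.1 (hcover ▸ mem_univ x)).resolve_left hx
    let g : ι → ℕ := fun x => if hx : x ∈ K then K.equivFin ⟨x, hx⟩ else K.card + f x
    have hgK : ∀ x, g x < K.card ↔ x ∈ K := by
      intro x
      by_cases hx : x ∈ K <;> simp [g, hx]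
    have hginj : ∀ x ∈ K, ∀ y ∈ K, g x = g y → x = y := by
      intro x hx y hy h
      simpa [g, hx, hy, Fin.val_inj] using h
    have hgS : ∀ x, x ∉ K → g x = K.card + f x := fun x hx => by simp [g, hx]
    have hglt : ∀ x, g x < K.card + 1 + ⌈2 * ∑ x, s x⌉₊ := by
      intro x
      by_cases hx : x ∈ K
      · have := (hgK x).2 hx
        omega
      · have := hft x (hcov x hx)
        rw [hgS x hx]
        omega
    refine ⟨fun i => univ.filter fun x => g x = i, fun x => ⟨⟨g x, hglt x⟩, by simp, ?_⟩, ?_, ?_⟩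
    · intro i hi
      ext
      simpa using (mem_filter.1 hi).2.symm
    · intro i u hu v hv huv
      have hu' := (mem_filter.1 hu).2
      have hv' := (mem_filter.1 hv).2
      have huvK : u ∈ K ↔ v ∈ K := by rw [← hgK, ← hgK, hu', hv']
      by_cases huK : u ∈ K
      · exact huv.ne (hginj u huK v (huvK.1 huK) (hu'.trans hv'.symm))
      · exact hS u (hcov u huK) v (hcov v (mt huvK.2 huK)) huv
    · intro i
      by_cases hi : (i : ℕ) < K.card
      · have hcard : (univ.filter fun x => g x = i).card ≤ 1 := by
          rw [card_le_one]
          intro x hx y hy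
          have hx' := (mem_filter.1 hx).2
          have hy' := (mem_filter.1 hy).2
          exact hginj x ((hgK x).1 (hx' ▸ hi)) y ((hgK y).1 (hy' ▸ hi)) (hx'.trans hy'.symm)
        have hsum := sum_le_card_nsmul (univ.filter fun x => g x = i) s 1 fun x _ => (hs x).2
        rw [nsmul_one] at hsum
        exact hsum.trans (by exact_mod_cast hcard)
      · refine le_trans (sum_le_sum_of_subset_of_nonneg ?_ fun x _ _ => (hs x).1)
          (hf (i - K.card))
        intro x hx
        have hx' := (mem_filter.1 hx).2
        have hxK : x ∉ K := fun h => hi (hx' ▸ (hgK x).2 h)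
        rw [hgS x hxK] at hx'
        exact mem_filter.2 ⟨hcov x hxK, by omega⟩
  refine ⟨?_, Nat.sInf_le hmem⟩
  obtain ⟨B, hB, hind, -⟩ := Nat.sInf_mem ⟨_, hmem⟩
  choose c hc _ using hB
  have hle := card_le_card_of_injOn (s := K) (t := univ) c (fun _ _ => mem_univ _) ?_
  · simpa using hle
  · intro u hu v hv huv
    by_contra hne
    exact hind (c u) u (hc u) v (huv ▸ hc v) (hK u hu v hv hne)
end

section
/- Let (I, s, E) be a bin packing with conflicts instance whose conflict graph G = (I, E) is bipartite with bipartition (X, Y). Let A_1, …, A_r be pairwise disjoint independent sets in G, each with s(A_i) ≤ 1, such that each A_i contains an item of X of size greater than 1/2. Then the union A_1 ∪ ⋯ ∪ A_r can be partitioned into at most (3/2)·r + 1 sets, each of which is entirely contained in X or entirely contained in Y and has total size at most 1 (and hence is an independent set in G). -/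
open Finset
open scoped Classical

/-- Let `(I, s, E)` be a bin packing with conflicts instance whose conflict
graph `G` is bipartite with bipartition `(X, Y)`. Let `A_1, …, A_r` be pairwise disjoint
independent sets in `G`, each of total size at most `1`, each containing an item of `X` of size
greater than `1/2`. Then `A_1 ∪ ⋯ ∪ A_r` can be partitioned into at most `(3/2)·r + 1` sets, each
entirely contained in `X` or in `Y`, of total size at most `1`. -/
theorem stmt_17 {ι : Type*} [Fintype ι] [DecidableEq ι]
    (s : ι → ℝ) (hs : ∀ x, s x ∈ Set.Icc (0 : ℝ) 1)
    (G : SimpleGraph ι)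
    (X Y : Finset ι) (hcover : X ∪ Y = univ) (hXY : Disjoint X Y)
    (hbip : ∀ u v : ι, G.Adj u v → (u ∈ X ∧ v ∈ Y) ∨ (u ∈ Y ∧ v ∈ X))
    (r : ℕ) (A : Fin r → Finset ι)
    (hdisj : ∀ i j, i ≠ j → Disjoint (A i) (A j))
    (hind : ∀ i, ∀ u ∈ A i, ∀ v ∈ A i, ¬ G.Adj u v)
    (hsize : ∀ i, ∑ x ∈ A i, s x ≤ 1)
    (hlarge : ∀ i, ∃ x ∈ A i, x ∈ X ∧ 1/2 < s x) :
    ∃ (m : ℕ) (B : Fin m → Finset ι),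
      (m : ℝ) ≤ 3/2 * (r : ℝ) + 1 ∧
      (∀ j, B j ⊆ univ.biUnion A) ∧
      (∀ x ∈ univ.biUnion A, ∃! j, x ∈ B j) ∧
      (∀ j, B j ⊆ X ∨ B j ⊆ Y) ∧
      (∀ j, ∑ x ∈ B j, s x ≤ 1) := by
  have hidx : ∀ x, ∃ i : ℕ, x ∈ univ.biUnion A → ∃ h : i < r, x ∈ A ⟨i, h⟩ := by
    intro x
    by_cases hx : x ∈ univ.biUnion A
    · obtain ⟨i, -, hi⟩ := mem_biUnion.1 hx
      exact ⟨i, fun _ => ⟨i.2, hi⟩⟩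
    · exact ⟨0, fun h => absurd h hx⟩
  choose idx hidx using hidx
  -- Each `A i ∩ X` gets its own bin; the parts outside `X` are packed two per bin.
  let bin : ι → ℕ := fun x => if x ∈ X then idx x else r + idx x / 2
  have hbin : ∀ x ∈ univ.biUnion A, bin x < r + (r + 1) / 2 := by
    intro x hx
    obtain ⟨h, -⟩ := hidx x hx
    simp only [bin]
    split_ifs <;> omega
  refine ⟨r + (r + 1) / 2, fun j => (univ.biUnion A).filter (fun x => bin x = j), ?_, ?_, ?_, ?_, ?_⟩
  · have h : 2 * (r + (r + 1) / 2) ≤ 3 * r + 1 := by omega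
    have h' : (2 : ℝ) * ((r + (r + 1) / 2 : ℕ) : ℝ) ≤ 3 * r + 1 := by exact_mod_cast h
    linarith
  · exact fun j => filter_subset _ _
  · intro x hx
    refine ⟨⟨bin x, hbin x hx⟩, by simpa using hx, fun j hj => ?_⟩
    exact Fin.ext (mem_filter.1 hj).2.symm
  · intro j
    by_cases hj : (j : ℕ) < r
    · left
      intro x hx
      obtain ⟨-, hb⟩ := mem_filter.1 hx
      by_contra hxX
      simp only [bin, if_neg hxX] at hb
      omega
    · right
      intro x hx
      obtain ⟨hxU, hb⟩ := mem_filter.1 hx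
      obtain ⟨hi, -⟩ := hidx x hxU
      have hxX : x ∉ X := by
        intro hxX
        simp only [bin, if_pos hxX] at hb
        omega
      have hxXY : x ∈ X ∪ Y := hcover ▸ mem_univ x
      exact (mem_union.1 hxXY).resolve_left hxX
  · intro j
    by_cases hj : (j : ℕ) < r
    · refine (sum_le_sum_of_subset_of_nonneg ?_ fun x _ _ => (hs x).1).trans (hsize ⟨j, hj⟩)
      intro x hx
      obtain ⟨hxU, hb⟩ := mem_filter.1 hx
      obtain ⟨hi, hxA⟩ := hidx x hxU
      have hij : idx x = j := by
        simp only [bin] at hb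
        split_ifs at hb <;> omega
      simpa only [hij] using hxA
    · let T : Finset (Fin r) := univ.filter (fun i => r + (i : ℕ) / 2 = j)
      have hT : T.card ≤ 2 := by
        have hmaps : ∀ i ∈ T, (i : ℕ) ∈ ({2 * (j - r), 2 * (j - r) + 1} : Finset ℕ) := by
          intro i hi
          have := (mem_filter.1 hi).2
          simp only [mem_insert, mem_singleton]
          omega
        exact (card_le_card_of_injOn _ hmaps Fin.val_injective.injOn).trans card_le_two
      have hhalf : ∀ i, ∑ x ∈ A i \ X, s x ≤ 1 / 2 := by
        intro i
        obtain ⟨x, hxA, hxX, hx⟩ := hlarge i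
        have hsub : A i \ X ⊆ (A i).erase x := by
          intro y hy
          obtain ⟨hyA, hyX⟩ := mem_sdiff.1 hy
          exact mem_erase.2 ⟨fun h => hyX (h ▸ hxX), hyA⟩
        have h₁ := sum_le_sum_of_subset_of_nonneg hsub fun y _ _ => (hs y).1
        have h₂ := add_sum_erase (A i) s hxA
        linarith [hsize i]
      have hsub : (univ.biUnion A).filter (fun x => bin x = j) ⊆
          T.biUnion (fun i => A i \ X) := by
        intro x hx
        obtain ⟨hxU, hb⟩ := mem_filter.1 hx
        obtain ⟨hi, hxA⟩ := hidx x hxU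
        have hxX : x ∉ X := by
          intro hxX
          simp only [bin, if_pos hxX] at hb
          omega
        simp only [bin, if_neg hxX] at hb
        exact mem_biUnion.2 ⟨⟨idx x, hi⟩, mem_filter.2 ⟨mem_univ _, hb⟩, mem_sdiff.2 ⟨hxA, hxX⟩⟩
      have hT' : (T.card : ℝ) ≤ 2 := by exact_mod_cast hT
      calc ∑ x ∈ (univ.biUnion A).filter (fun x => bin x = j), s x
          ≤ ∑ x ∈ T.biUnion (fun i => A i \ X), s x :=
            sum_le_sum_of_subset_of_nonneg hsub fun x _ _ => (hs x).1
        _ = ∑ i ∈ T, ∑ x ∈ A i \ X, s x :=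
            sum_biUnion fun i _ k _ hik => (hdisj i k hik).mono sdiff_subset sdiff_subset
        _ ≤ T.card • (1 / 2 : ℝ) := sum_le_card_nsmul _ _ _ fun i _ => hhalf i
        _ ≤ 1 := by rw [nsmul_eq_mul]; linarith
end

section
/- Let X, Y, Z be pairwise disjoint finite sets, let T ⊆ X × Y × Z be such that every element of U = X ∪ Y ∪ Z appears as a coordinate of at least one triple of T, and let M ⊆ T be a solution (its triples are pairwise disjoint in all coordinates) with |M| = i. Construct the following conflict instance: the items are the elements of U (each of size 0.15), the triples of T (each of size 0.55), a set P of |T| − i additional items of size 0.45, and a set Q of |X| + |Y| + |Z| − 3i additional items of size 0.85; two items conflict if and only if one is an element u ∈ U, the other is a triple t ∈ T, and u is not a coordinate of t. Then this instance admits a packing into exactly |T| + |X| + |Y| + |Z| − 3i bins in which every bin has total size exactly 1; consequently the minimum number of bins of this instance equals |T| + |X| + |Y| + |Z| − 3i, which equals the total size of all items. -/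
open Finset

/-- Items of the reduced BPC instance: elements of `U = X ∪ Y ∪ Z`, triples of `T`, `|T| − i`
filler items `P` and `|X| + |Y| + |Z| − 3i` filler items `Q`. -/
abbrev ReducedItem {α : Type*} [DecidableEq α]
    (X Y Z : Finset α) (T : Finset (α × α × α)) (i : ℕ) : Type _ :=
  ({u : α // u ∈ X ∪ Y ∪ Z} ⊕ {t : α × α × α // t ∈ T}) ⊕
    (Fin (T.card - i) ⊕ Fin (X.card + Y.card + Z.card - 3 * i))

/-- Sizes of the items of the reduced instance: `0.15` for elements, `0.55` for triples, `0.45`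
for `P`-fillers and `0.85` for `Q`-fillers. -/
def reducedSize {α : Type*} [DecidableEq α]
    (X Y Z : Finset α) (T : Finset (α × α × α)) (i : ℕ) :
    ReducedItem X Y Z T i → ℝ
  | .inl (.inl _) => 0.15
  | .inl (.inr _) => 0.55
  | .inr (.inl _) => 0.45
  | .inr (.inr _) => 0.85

/-- The conflict relation: an element `u ∈ U` conflicts with a triple `t ∈ T` iff `u` is not a
coordinate of `t`; there are no other conflicts. -/
def reducedConflict {α : Type*} [DecidableEq α]
    (X Y Z : Finset α) (T : Finset (α × α × α)) (i : ℕ) :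
    ReducedItem X Y Z T i → ReducedItem X Y Z T i → Prop
  | .inl (.inl u), .inl (.inr t) =>
      ¬ (t.val.1 = u.val ∨ t.val.2.1 = u.val ∨ t.val.2.2 = u.val)
  | _, _ => False

/-- The set of coordinates of a triple. -/
def tripleCoords {α : Type*} [DecidableEq α] (t : α × α × α) : Finset α :=
  {t.1, t.2.1, t.2.2}

lemma mem_tripleCoords {α : Type*} [DecidableEq α] {t : α × α × α} {u : α} :
    u ∈ tripleCoords t ↔ t.1 = u ∨ t.2.1 = u ∨ t.2.2 = u := by
  simp [tripleCoords, eq_comm]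

lemma card_tripleCoords {α : Type*} [DecidableEq α] {X Y Z : Finset α}
    (hXY : Disjoint X Y) (hXZ : Disjoint X Z) (hYZ : Disjoint Y Z) {t : α × α × α}
    (ht : t.1 ∈ X ∧ t.2.1 ∈ Y ∧ t.2.2 ∈ Z) : (tripleCoords t).card = 3 :=
  Finset.card_eq_three.2 ⟨_, _, _, Finset.disjoint_iff_ne.1 hXY _ ht.1 _ ht.2.1,
    Finset.disjoint_iff_ne.1 hXZ _ ht.1 _ ht.2.2,
    Finset.disjoint_iff_ne.1 hYZ _ ht.2.1 _ ht.2.2, rfl⟩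

/-- Elements covered by a family `M` of triples with pairwise disjoint coordinate sets can be sent
to the triple of `M` covering them, and the uncovered ones bijectively to `Fin q`. -/
lemma exists_element_assignment {α : Type*} [DecidableEq α] {U : Finset α}
    {T M : Finset (α × α × α)} (hM : M ⊆ T)
    (hdisj : (M : Set (α × α × α)).PairwiseDisjoint tripleCoords) {q : ℕ}
    (hq : (U \ M.biUnion tripleCoords).card = q) :
    ∃ a : {u // u ∈ U} → {t // t ∈ T} ⊕ Fin q,
      (∀ t u, a u = .inl t ↔ t.1 ∈ M ∧ u.1 ∈ tripleCoords t.1) ∧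
      ∀ k, (univ.filter fun u => a u = .inr k).card = 1 := by
  classical
  let e := Finset.equivFinOfCardEq hq
  have hcov : ∀ u : {u // u ∈ U}, u.1 ∈ M.biUnion tripleCoords →
      ∃ t : {t // t ∈ T}, t.1 ∈ M ∧ u.1 ∈ tripleCoords t.1 := by
    intro u hu
    obtain ⟨t, ht, hut⟩ := Finset.mem_biUnion.1 hu
    exact ⟨⟨t, hM ht⟩, ht, hut⟩
  choose g hgM hg using hcov
  refine ⟨fun u => if h : u.1 ∈ M.biUnion tripleCoords then .inl (g u h)
    else .inr (e ⟨u.1, Finset.mem_sdiff.2 ⟨u.2, h⟩⟩), fun t u => ?_, fun k => ?_⟩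
  · by_cases h : u.1 ∈ M.biUnion tripleCoords
    · simp only [h, dite_true, Sum.inl.injEq]
      refine ⟨fun hgt => hgt ▸ ⟨hgM u h, hg u h⟩, fun ht => Subtype.ext ?_⟩
      by_contra hne
      exact Finset.disjoint_left.1 (hdisj (hgM u h) ht.1 hne) (hg u h) ht.2
    · simp only [h, dite_false, reduceCtorEq, false_iff]
      exact fun ht => h (Finset.mem_biUnion.2 ⟨t, ht⟩)
  · have hk := Finset.mem_sdiff.1 (e.symm k).2
    refine Finset.card_eq_one.2 ⟨⟨(e.symm k).1, hk.1⟩, Finset.ext fun u => ?_⟩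
    simp only [Finset.mem_filter, Finset.mem_univ, true_and, Finset.mem_singleton]
    by_cases h : u.1 ∈ M.biUnion tripleCoords
    · simp only [h, dite_true, reduceCtorEq, false_iff]
      rintro rfl
      exact hk.2 h
    · simp only [h, dite_false, Sum.inr.injEq, ← Equiv.eq_symm_apply, Subtype.ext_iff]

lemma card_filter_subtype_mem {α : Type*} [DecidableEq α] {U S : Finset α} (h : S ⊆ U) :
    (univ.filter fun u : {u // u ∈ U} => u.1 ∈ S).card = S.card := by
  rw [← Finset.card_map (Function.Embedding.subtype _)]
  congr 1
  ext u
  simpa using fun hu => h hu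

lemma exists_filler_assignment {β : Type*} [DecidableEq β] {T M : Finset β} {p : ℕ}
    (hp : (T \ M).card = p) :
    ∃ b : Fin p → {t // t ∈ T},
      ∀ t, (univ.filter fun k => b k = t).card = if t.1 ∈ M then 0 else 1 := by
  let e := Finset.equivFinOfCardEq hp
  refine ⟨fun k => ⟨(e.symm k).1, (Finset.mem_sdiff.1 (e.symm k).2).1⟩, fun t => ?_⟩
  split_ifs with h
  · refine Finset.card_eq_zero.2 (Finset.filter_eq_empty_iff.2 fun k _ hk => ?_)
    exact (Finset.mem_sdiff.1 (e.symm k).2).2 (by rw [congrArg Subtype.val hk]; exact h)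
  · refine Finset.card_eq_one.2 ⟨e ⟨t.1, Finset.mem_sdiff.2 ⟨t.2, h⟩⟩, Finset.ext fun k => ?_⟩
    simp [← Equiv.symm_apply_eq, Subtype.ext_iff]

lemma sum_eq_sum_bins {ι κ : Type*} [Fintype ι] [Fintype κ] {B : κ → Finset ι}
    (hB : ∀ x, ∃! j, x ∈ B j) (s : ι → ℝ) : ∑ x, s x = ∑ j, ∑ x ∈ B j, s x := by
  classical
  choose f hf hf' using hB
  rw [← Finset.sum_fiberwise univ f s]
  refine Finset.sum_congr rfl fun j _ => Finset.sum_congr (Finset.ext fun x => ?_) fun _ _ => rfl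
  simp only [Finset.mem_filter, Finset.mem_univ, true_and]
  exact ⟨fun h => h ▸ hf x, fun h => (hf' x j h).symm⟩

/-- The size of a fibre of an item assignment, in terms of the number of items of each kind. -/
lemma sum_reducedSize_fiber {α β : Type*} [DecidableEq α] [DecidableEq β]
    (X Y Z : Finset α) (T : Finset (α × α × α)) (i : ℕ)
    (fU : {u // u ∈ X ∪ Y ∪ Z} → β) (fT : {t // t ∈ T} → β) (fP : Fin (T.card - i) → β)
    (fQ : Fin (X.card + Y.card + Z.card - 3 * i) → β) (b : β) :
    ∑ x with Sum.elim (Sum.elim fU fT) (Sum.elim fP fQ) x = b, reducedSize X Y Z T i x =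
      (univ.filter fun u => fU u = b).card * 0.15 +
      (univ.filter fun t => fT t = b).card * 0.55 +
      ((univ.filter fun p => fP p = b).card * 0.45 +
      (univ.filter fun q => fQ q = b).card * 0.85) := by
  simp only [Finset.card_filter, Nat.cast_sum, Finset.sum_mul]
  rw [Finset.sum_filter, Fintype.sum_sum_type, Fintype.sum_sum_type, Fintype.sum_sum_type]
  simp only [Sum.elim_inl, Sum.elim_inr, reducedSize, Nat.cast_ite, Nat.cast_one, Nat.cast_zero,
    ite_mul, one_mul, zero_mul]
  rfl

lemma exists_perfect_packing {α : Type*} [DecidableEq α]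
    {X Y Z : Finset α} {T : Finset (α × α × α)}
    (hXY : Disjoint X Y) (hXZ : Disjoint X Z) (hYZ : Disjoint Y Z)
    (hT : ∀ t ∈ T, t.1 ∈ X ∧ t.2.1 ∈ Y ∧ t.2.2 ∈ Z)
    {M : Finset (α × α × α)} (hM : M ⊆ T)
    (hmatch : ∀ u ∈ X ∪ Y ∪ Z,
      (M.filter fun t => t.1 = u ∨ t.2.1 = u ∨ t.2.2 = u).card ≤ 1)
    {i : ℕ} (hi : M.card = i) :
    ∃ B : Fin (T.card + X.card + Y.card + Z.card - 3 * i) → Finset (ReducedItem X Y Z T i),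
      (∀ x, ∃! j, x ∈ B j) ∧
      (∀ j, ∀ u ∈ B j, ∀ v ∈ B j,
        ¬ (SimpleGraph.fromRel (reducedConflict X Y Z T i)).Adj u v) ∧
      (∀ j, ∑ x ∈ B j, reducedSize X Y Z T i x = 1) := by
  have hU : ∀ t ∈ T, tripleCoords t ⊆ X ∪ Y ∪ Z := by
    intro t ht u hu
    obtain ⟨h1, h2, h3⟩ := hT t ht
    simp only [Finset.mem_union]
    rcases mem_tripleCoords.1 hu with rfl | rfl | rfl <;> tauto
  have hdisj : (M : Set (α × α × α)).PairwiseDisjoint tripleCoords := by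
    intro t ht t' ht' hne
    refine Finset.disjoint_left.2 fun u hu hu' => hne ?_
    exact Finset.card_le_one.1 (hmatch u (hU t (hM ht) hu)) _
      (Finset.mem_filter.2 ⟨ht, mem_tripleCoords.1 hu⟩) _
      (Finset.mem_filter.2 ⟨ht', mem_tripleCoords.1 hu'⟩)
  have hcard : (M.biUnion tripleCoords).card = 3 * i := by
    rw [Finset.card_biUnion hdisj,
      Finset.sum_congr rfl fun t ht => card_tripleCoords hXY hXZ hYZ (hT t (hM ht))]
    simp [hi, mul_comm]
  have hsub : M.biUnion tripleCoords ⊆ X ∪ Y ∪ Z :=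
    Finset.biUnion_subset.2 fun t ht => hU t (hM ht)
  have hUcard : (X ∪ Y ∪ Z).card = X.card + Y.card + Z.card := by
    rw [Finset.card_union_of_disjoint (Finset.disjoint_union_left.2 ⟨hXZ, hYZ⟩),
      Finset.card_union_of_disjoint hXY]
  have hle : 3 * i ≤ X.card + Y.card + Z.card := by
    rw [← hcard, ← hUcard]
    exact Finset.card_le_card hsub
  obtain ⟨a, ha, ha'⟩ := exists_element_assignment (q := X.card + Y.card + Z.card - 3 * i) hM hdisj
    (by rw [Finset.card_sdiff_of_subset hsub, hcard, hUcard])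
  obtain ⟨b, hb⟩ := exists_filler_assignment (p := T.card - i)
    (by rw [Finset.card_sdiff_of_subset hM, hi])
  let f : ReducedItem X Y Z T i → {t // t ∈ T} ⊕ Fin (X.card + Y.card + Z.card - 3 * i) :=
    Sum.elim (Sum.elim a .inl) (Sum.elim (fun p => .inl (b p)) .inr)
  let e : Fin (T.card + X.card + Y.card + Z.card - 3 * i) ≃
      {t // t ∈ T} ⊕ Fin (X.card + Y.card + Z.card - 3 * i) :=
    (Fintype.equivFinOfCardEq (by simp; omega)).symm
  have hconf : ∀ x y, reducedConflict X Y Z T i x y → f x ≠ f y := by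
    rintro ((u | t) | (p | q)) ((u' | t') | (p' | q')) h <;> try exact h.elim
    exact fun hf => h (mem_tripleCoords.1 ((ha t' u).1 hf).2)
  refine ⟨fun j => univ.filter fun x => f x = e j, fun x => ⟨e.symm (f x), by simp, ?_⟩, ?_, ?_⟩
  · intro j hj
    simp only [Finset.mem_filter, Finset.mem_univ, true_and] at hj
    simp [hj]
  · intro j u hu v hv hadj
    simp only [Finset.mem_filter, Finset.mem_univ, true_and] at hu hv
    rcases ((SimpleGraph.fromRel_adj _ _ _).1 hadj).2 with h | h
    · exact hconf _ _ h (hu.trans hv.symm)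
    · exact hconf _ _ h (hv.trans hu.symm)
  · intro j
    refine (sum_reducedSize_fiber X Y Z T i a .inl (fun p => .inl (b p)) .inr (e j)).trans ?_
    rcases e j with t | k
    · have hcount : (univ.filter fun u => a u = .inl t).card = if t.1 ∈ M then 3 else 0 := by
        simp only [ha]
        split_ifs with h
        · simp only [h, true_and]
          rw [card_filter_subtype_mem (hU _ t.2), card_tripleCoords hXY hXZ hYZ (hT _ t.2)]
        · simp [h]
      simp only [Sum.inl.injEq, reduceCtorEq, hcount, hb,
        Finset.filter_false, Finset.card_empty, Finset.filter_eq', Finset.mem_univ, if_true,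
        Finset.card_singleton]
      split_ifs <;> norm_num
    · simp only [Sum.inr.injEq, reduceCtorEq, ha',
        Finset.filter_false, Finset.card_empty, Finset.filter_eq', Finset.mem_univ, if_true,
        Finset.card_singleton]
      norm_num

/-- Given a B3DM instance `(X, Y, Z, T)` in which every element of
`U = X ∪ Y ∪ Z` appears in at least one triple, and a solution `M ⊆ T` with `|M| = i`, the reduced
bin packing with conflicts instance admits a packing into exactly
`N = |T| + |X| + |Y| + |Z| − 3i` bins each of total size exactly `1`; consequently its optimum
equals `N`, which equals the total size of all items. -/
theorem stmt_18 {α : Type*} [DecidableEq α]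
    (X Y Z : Finset α) (T : Finset (α × α × α))
    (hXY : Disjoint X Y) (hXZ : Disjoint X Z) (hYZ : Disjoint Y Z)
    (hT : ∀ t ∈ T, t.1 ∈ X ∧ t.2.1 ∈ Y ∧ t.2.2 ∈ Z)
    (hcoverU : ∀ u ∈ X ∪ Y ∪ Z, ∃ t ∈ T, t.1 = u ∨ t.2.1 = u ∨ t.2.2 = u)
    (M : Finset (α × α × α)) (hM : M ⊆ T)
    (hmatch : ∀ u ∈ X ∪ Y ∪ Z,
      (M.filter fun t => t.1 = u ∨ t.2.1 = u ∨ t.2.2 = u).card ≤ 1)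
    (i : ℕ) (hi : M.card = i) :
    (∃ B : Fin (T.card + X.card + Y.card + Z.card - 3 * i) →
        Finset (ReducedItem X Y Z T i),
      (∀ x, ∃! j, x ∈ B j) ∧
      (∀ j, ∀ u ∈ B j, ∀ v ∈ B j,
        ¬ (SimpleGraph.fromRel (reducedConflict X Y Z T i)).Adj u v) ∧
      (∀ j, ∑ x ∈ B j, reducedSize X Y Z T i x = 1)) ∧
    sInf {t : ℕ | ∃ B : Fin t → Finset (ReducedItem X Y Z T i),
        (∀ x, ∃! j, x ∈ B j) ∧
        (∀ j, ∀ u ∈ B j, ∀ v ∈ B j,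
          ¬ (SimpleGraph.fromRel (reducedConflict X Y Z T i)).Adj u v) ∧
        (∀ j, ∑ x ∈ B j, reducedSize X Y Z T i x ≤ 1)}
      = T.card + X.card + Y.card + Z.card - 3 * i ∧
    ((T.card + X.card + Y.card + Z.card - 3 * i : ℕ) : ℝ)
      = ∑ x : ReducedItem X Y Z T i, reducedSize X Y Z T i x := by
  obtain ⟨B, hB, hBc, hBs⟩ := exists_perfect_packing hXY hXZ hYZ hT hM hmatch hi
  have htotal : ((T.card + X.card + Y.card + Z.card - 3 * i : ℕ) : ℝ)
      = ∑ x : ReducedItem X Y Z T i, reducedSize X Y Z T i x := by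
    rw [sum_eq_sum_bins hB, Finset.sum_congr rfl fun j _ => hBs j]
    simp
  refine ⟨⟨B, hB, hBc, hBs⟩, IsLeast.csInf_eq ⟨⟨B, hB, hBc, fun j => (hBs j).le⟩, ?_⟩, htotal⟩
  rintro t ⟨B', hB', -, hB's⟩
  have h : ∑ x : ReducedItem X Y Z T i, reducedSize X Y Z T i x ≤ t := by
    rw [sum_eq_sum_bins hB']
    exact (Finset.sum_le_sum fun j _ => hB's j).trans (by simp)
  exact_mod_cast htotal.trans_le h
end
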